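/- Let d ≥ 3 and let (E_n) be the external DLA process on Z^d started from E_0 = {0}, where at each step a new vertex is added to the boundary of the current cluster according to the harmonic measure from infinity. Then there exists a constant C(d) < ∞ such that, with probability 1, limsup_{n→∞} n^{-2/d} r(E_n) ≤ C(d), where r(E_n) = max{|x| : x ∈ E_n}. -/

import Mathlib

open MeasureTheory Filter Topology

/-- The lattice neighbors of a point of `ℤ^d` (the `2d` points at `ℓ¹`-distance one). -/
noncomputable def latNbrs {d : ℕ} (x : Fin d → ℤ) : Finset (Fin d → ℤ) :=
  (Finset.univ ×ˢ ({1, -1} : Finset ℤ)).image (fun p => Function.update x p.1 (x p.1 + p.2))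

open Classical in
/-- Probability that the random walk which at each step moves uniformly to one of the
points in `nbr ·`, started at `x`, hits the set `A` within `n` steps, with first
hitting position `y`. -/
noncomputable def hitP {V : Type*} (nbr : V → Finset V) (A : Set V) : ℕ → V → V → ℝ
  | 0, x, y => if x ∈ A ∧ x = y then 1 else 0
  | n+1, x, y =>
      if x ∈ A then (if x = y then 1 else 0)
      else ((nbr x).card : ℝ)⁻¹ * ∑ z ∈ nbr x, hitP nbr A n z y

/-- The hitting distribution `H_A(x,y)`: probability that the random walk started at `x`
ever hits `A`, with first hitting position `y` (monotone limit of `hitP`). -/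
noncomputable def hitMeas {V : Type*} (nbr : V → Finset V) (A : Set V) (x y : V) : ℝ :=
  ⨆ n, hitP nbr A n x y

/-- Outer boundary of a finite set. -/
noncomputable def bdryF {V : Type*} [DecidableEq V] (nbr : V → Finset V) (A : Finset V) :
    Finset V :=
  A.biUnion nbr \ A

/-- Euclidean norm of a lattice point. -/
noncomputable def eunorm {d : ℕ} (x : Fin d → ℤ) : ℝ := Real.sqrt (∑ i, ((x i : ℝ)) ^ 2)

/-- Radius of a cluster: `r(A) = max {|x| : x ∈ A}`. -/
noncomputable def radE {d : ℕ} (A : Finset (Fin d → ℤ)) : ℝ := ⨆ x ∈ A, eunorm x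

lemma sum_latNbrs {d : ℕ} {M : Type*} [AddCommMonoid M] (x : Fin d → ℤ)
    (f : (Fin d → ℤ) → M) :
    ∑ z ∈ latNbrs x, f z = ∑ i, (f (x + Pi.single i 1) + f (x - Pi.single i 1)) := by
  have key : ∀ (i : Fin d) (s : ℤ), Function.update x i (x i + s) = x + Pi.single i s := by
    intro i s
    ext j
    by_cases h : j = i
    · subst h; simp
    · simp [h]
  unfold latNbrs
  rw [Finset.sum_image, Finset.sum_product]
  · refine Finset.sum_congr rfl fun i _ => ?_
    rw [Finset.sum_pair (by norm_num)]
    simp only [key]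
    rw [sub_eq_add_neg, ← Pi.single_neg]
  · rintro ⟨i, s⟩ hi ⟨j, t⟩ hj hij
    simp only [Finset.coe_product, Set.mem_prod, Finset.mem_coe, Finset.mem_insert,
      Finset.mem_singleton, Finset.mem_univ, true_and] at hi hj
    simp only [key, add_right_inj] at hij
    have hs : s ≠ 0 := by rcases hi with h | h <;> simp [h]
    have h1 := congrFun hij i
    by_cases h : i = j
    · subst h
      simpa using h1
    · rw [Pi.single_eq_same, Pi.single_eq_of_ne h] at h1
      exact absurd h1 hs

lemma card_latNbrs {d : ℕ} (x : Fin d → ℤ) : (latNbrs x).card = 2 * d := by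
  rw [Finset.card_eq_sum_ones, sum_latNbrs]
  simp [mul_comm]

lemma mem_latNbrs {d : ℕ} {x z : Fin d → ℤ} :
    z ∈ latNbrs x ↔ ∃ i, z = x + Pi.single i 1 ∨ z = x - Pi.single i 1 := by
  have h := sum_latNbrs x (fun w => if w = z then 1 else 0)
  constructor
  · intro hz
    by_contra! hne
    rw [Finset.sum_eq_zero (s := Finset.univ)] at h
    · simp [hz] at h
    · intro i _
      simp [(hne i).1.symm, (hne i).2.symm]
  · rintro ⟨i, hi⟩
    by_contra hz
    simp only [Finset.sum_ite_eq', hz, if_false] at h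
    have h' := (Finset.sum_eq_zero_iff.1 h.symm) i (Finset.mem_univ i)
    rcases hi with hi | hi <;> simp [hi] at h'

lemma latNbrs_symm {d : ℕ} {x z : Fin d → ℤ} (h : z ∈ latNbrs x) : x ∈ latNbrs z := by
  obtain ⟨i, hi | hi⟩ := mem_latNbrs.1 h
  · exact mem_latNbrs.2 ⟨i, Or.inr (by simp [hi])⟩
  · exact mem_latNbrs.2 ⟨i, Or.inl (by simp [hi])⟩

/-- The `k`-step transition probability of simple random walk from `x` to the origin. -/
noncomputable def walkP {d : ℕ} : ℕ → (Fin d → ℤ) → ℝ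
  | 0, x => if x = 0 then 1 else 0
  | k + 1, x => (2 * d : ℝ)⁻¹ * ∑ i, (walkP k (x + Pi.single i 1) + walkP k (x - Pi.single i 1))

lemma walkP_nonneg {d : ℕ} (k : ℕ) (x : Fin d → ℤ) : 0 ≤ walkP k x := by
  induction k generalizing x with
  | zero => unfold walkP; split_ifs <;> norm_num
  | succ k ih =>
    unfold walkP
    exact mul_nonneg (by positivity) (Finset.sum_nonneg fun i _ => add_nonneg (ih _) (ih _))

lemma hasSum_walkP {d : ℕ} (hd : d ≠ 0) (k : ℕ) : HasSum (walkP (d := d) k) 1 := by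
  induction k with
  | zero => exact hasSum_ite_eq 0 1
  | succ k ih =>
    have h1 : ∀ v : Fin d → ℤ, HasSum (fun x => walkP k (x + v)) 1 := fun v =>
      (Equiv.hasSum_iff (f := walkP k) (Equiv.addRight v)).2 ih
    have h2 : ∀ v : Fin d → ℤ, HasSum (fun x => walkP k (x - v)) 1 := fun v =>
      (Equiv.hasSum_iff (f := walkP k) (Equiv.subRight v)).2 ih
    have h := (hasSum_sum (s := Finset.univ) fun (i : Fin d) _ =>
      (h1 (Pi.single i 1)).add (h2 (Pi.single i 1))).mul_left (2 * d : ℝ)⁻¹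
    have hd' : (d : ℝ) ≠ 0 := by exact_mod_cast hd
    have e : (2 * d : ℝ)⁻¹ * ∑ i : Fin d, ((1 : ℝ) + 1) = 1 := by
      rw [Finset.sum_const, Finset.card_univ, Fintype.card_fin, nsmul_eq_mul]
      field_simp
      norm_num
    rw [e] at h
    exact h

lemma walkP_eq_zero {d : ℕ} {k : ℕ} {x : Fin d → ℤ}
    (hx : x ∉ Finset.Icc (fun _ => -(k : ℤ)) (fun _ => (k : ℤ))) : walkP k x = 0 := by
  induction k generalizing x with
  | zero =>
    have : x ≠ 0 := by
      rintro rfl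
      apply hx
      simp [Pi.zero_def]
    simp [walkP, this]
  | succ k ih =>
    have hs : ∀ (i j : Fin d), |(Pi.single i (1 : ℤ) : Fin d → ℤ) j| ≤ 1 := by
      intro i j
      by_cases h : j = i
      · subst h; simp
      · simp [h]
    unfold walkP
    rw [Finset.sum_eq_zero, mul_zero]
    intro i _
    rw [ih, ih, add_zero]
    all_goals
      contrapose! hx
      simp only [Finset.mem_Icc, Pi.le_def, Pi.add_apply, Pi.sub_apply] at hx ⊢
      constructor <;> intro j <;> have h1 := hx.1 j <;> have h2 := hx.2 j <;>
        have h3 := abs_le.1 (hs i j) <;> push_cast <;> omega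

lemma sum_Icc_walkP {d : ℕ} (hd : d ≠ 0) {k R : ℕ} (hk : k ≤ R) :
    ∑ x ∈ Finset.Icc (fun _ : Fin d => -(R : ℤ)) (fun _ => (R : ℤ)), walkP k x = 1 := by
  refine (hasSum_sum_of_ne_finset_zero fun x hx => walkP_eq_zero fun h => hx ?_).unique
    (hasSum_walkP hd k)
  simp only [Finset.mem_Icc, Pi.le_def] at h ⊢
  constructor <;> intro j <;> have h1 := h.1 j <;> have h2 := h.2 j <;> omega

open Real in
/-- Uniform measure (of total mass `2π`) on one period. -/
noncomputable def periodMeasure : Measure ℝ := volume.restrict (Set.Ioc (-π) π)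

instance : IsFiniteMeasure periodMeasure := by
  unfold periodMeasure
  infer_instance

lemma integral_periodMeasure {E : Type*} [NormedAddCommGroup E] [NormedSpace ℝ E] (f : ℝ → E) :
    ∫ t, f t ∂periodMeasure = ∫ t in (-Real.pi)..Real.pi, f t := by
  rw [intervalIntegral.integral_of_le (by linarith [Real.pi_pos])]
  rfl

lemma integral_exp_int (n : ℤ) :
    ∫ t, Complex.exp (n * t * Complex.I) ∂periodMeasure = if n = 0 then (2 * Real.pi : ℂ) else 0 := by
  rw [integral_periodMeasure]
  split_ifs with h
  · simp [h]
    ring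
  · have hc : (n * Complex.I : ℂ) ≠ 0 := by simp [h]
    have h1 := integral_exp_mul_complex (a := -Real.pi) (b := Real.pi) hc
    have h2 : ∀ t : ℝ, (n * t * Complex.I : ℂ) = n * Complex.I * t := fun t => by ring
    simp only [h2, h1]
    have h3 : Complex.exp (n * Complex.I * Real.pi) =
        Complex.exp (n * Complex.I * ((-Real.pi : ℝ) : ℂ)) := by
      rw [Complex.exp_eq_exp_iff_exists_int]
      exact ⟨n, by push_cast; ring⟩
    rw [h3, sub_self, zero_div]

/-- The characteristic function of a step of simple random walk. -/
noncomputable def stepChar {d : ℕ} (θ : Fin d → ℝ) : ℝ := (d : ℝ)⁻¹ * ∑ i, Real.cos (θ i)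

/-- The character of the torus attached to a lattice point. -/
noncomputable def latChar {d : ℕ} (x : Fin d → ℤ) (θ : Fin d → ℝ) : ℂ :=
  ∏ i, Complex.exp (x i * θ i * Complex.I)

lemma continuous_stepChar {d : ℕ} : Continuous (stepChar (d := d)) := by
  unfold stepChar
  fun_prop

lemma continuous_latChar {d : ℕ} (x : Fin d → ℤ) : Continuous (latChar x) := by
  unfold latChar
  fun_prop

lemma norm_latChar {d : ℕ} (x : Fin d → ℤ) (θ : Fin d → ℝ) : ‖latChar x θ‖ = 1 := by
  unfold latChar
  rw [norm_prod]
  refine Finset.prod_eq_one fun i _ => ?_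
  have := Complex.norm_exp_ofReal_mul_I (x i * θ i)
  push_cast at this
  exact this

lemma latChar_add {d : ℕ} (x y : Fin d → ℤ) (θ : Fin d → ℝ) :
    latChar (x + y) θ = latChar x θ * latChar y θ := by
  unfold latChar
  rw [← Finset.prod_mul_distrib]
  refine Finset.prod_congr rfl fun i _ => ?_
  rw [← Complex.exp_add]
  congr 1
  simp
  ring

lemma latChar_single {d : ℕ} (i : Fin d) (s : ℤ) (θ : Fin d → ℝ) :
    latChar (Pi.single i s) θ = Complex.exp (s * θ i * Complex.I) := by
  unfold latChar
  rw [Finset.prod_eq_single i]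
  · simp
  · intro j _ hj
    simp [hj]
  · simp

lemma sum_latChar {d : ℕ} (x : Fin d → ℤ) (θ : Fin d → ℝ) :
    (2 * d : ℂ)⁻¹ * ∑ i, (latChar (x + Pi.single i 1) θ + latChar (x - Pi.single i 1) θ) =
      stepChar θ * latChar x θ := by
  have h : ∀ i, latChar (x + Pi.single i 1) θ + latChar (x - Pi.single i 1) θ =
      2 * Complex.cos (θ i) * latChar x θ := by
    intro i
    rw [sub_eq_add_neg, ← Pi.single_neg, latChar_add, latChar_add, latChar_single, latChar_single,
      Complex.two_cos]
    push_cast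
    ring_nf
  simp only [h, ← Finset.sum_mul, ← Finset.mul_sum]
  unfold stepChar
  push_cast
  rw [mul_inv]
  ring

lemma abs_stepChar_le {d : ℕ} (hd : d ≠ 0) (θ : Fin d → ℝ) :
    |stepChar θ| ≤ Real.exp (-(2 * d : ℝ)⁻¹ * ∑ i, Real.sin (θ i) ^ 2) := by
  have hd' : (0 : ℝ) < d := by positivity
  have hc : ∀ i, |Real.cos (θ i)| ≤ 1 - Real.sin (θ i) ^ 2 / 2 := by
    intro i
    nlinarith [Real.sin_sq_add_cos_sq (θ i), sq_abs (Real.cos (θ i)), sq_nonneg (|Real.cos (θ i)| - 1)]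
  calc |stepChar θ| ≤ (d : ℝ)⁻¹ * ∑ i, |Real.cos (θ i)| := by
        unfold stepChar
        rw [abs_mul, abs_of_pos (inv_pos.2 hd')]
        gcongr
        exact Finset.abs_sum_le_sum_abs _ _
    _ ≤ (d : ℝ)⁻¹ * ∑ i, (1 - Real.sin (θ i) ^ 2 / 2) := by
        gcongr with i
        exact hc i
    _ = -(2 * d : ℝ)⁻¹ * ∑ i, Real.sin (θ i) ^ 2 + 1 := by
        rw [Finset.sum_sub_distrib, ← Finset.sum_div]
        simp
        field_simp
        ring
    _ ≤ _ := Real.add_one_le_exp _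

lemma integrable_torus {d : ℕ} {E : Type*} [NormedAddCommGroup E] {f : (Fin d → ℝ) → E}
    (hf : Continuous f) {C : ℝ} (hC : ∀ θ, ‖f θ‖ ≤ C) :
    Integrable f (Measure.pi fun _ => periodMeasure) :=
  Integrable.of_bound hf.aestronglyMeasurable C (ae_of_all _ hC)

lemma abs_stepChar_le_one {d : ℕ} (hd : d ≠ 0) (θ : Fin d → ℝ) : |stepChar θ| ≤ 1 := by
  refine (abs_stepChar_le hd θ).trans (Real.exp_le_one_iff.2 ?_)
  rw [neg_mul, neg_nonpos]
  exact mul_nonneg (by positivity) (Finset.sum_nonneg fun i _ => sq_nonneg _)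

lemma walkP_fourier {d : ℕ} (hd : d ≠ 0) (k : ℕ) (x : Fin d → ℤ) :
    ∫ θ, (stepChar θ : ℂ) ^ k * latChar x θ ∂(Measure.pi fun _ : Fin d => periodMeasure) =
      (2 * Real.pi : ℂ) ^ d * walkP k x := by
  have integrable_char : ∀ (k : ℕ) (x : Fin d → ℤ), Integrable (fun θ => (stepChar θ : ℂ) ^ k * latChar x θ)
      (Measure.pi fun _ : Fin d => periodMeasure) := by
    intro k x
    refine integrable_torus (C := 1) ?_ fun θ => ?_
    · exact ((Complex.continuous_ofReal.comp continuous_stepChar).pow k).mul (continuous_latChar x)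
    · rw [norm_mul, norm_latChar, mul_one, norm_pow, Complex.norm_real, Real.norm_eq_abs]
      exact pow_le_one₀ (abs_nonneg _) (abs_stepChar_le_one hd θ)
  induction k generalizing x with
  | zero =>
    simp only [pow_zero, one_mul, latChar]
    rw [integral_fintype_prod_eq_prod (𝕜 := ℂ) (f := fun i (t : ℝ) => Complex.exp (x i * t * Complex.I))]
    simp only [integral_exp_int, walkP]
    split_ifs with h
    · simp [h]
    · obtain ⟨i, hi⟩ := Function.ne_iff.1 h
      rw [Finset.prod_eq_zero (Finset.mem_univ i)]
      · simp
      · simpa using hi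
  | succ k ih =>
    have h1 : ∀ θ : Fin d → ℝ, (stepChar θ : ℂ) ^ (k + 1) * latChar x θ = (2 * d : ℂ)⁻¹ *
        ∑ i, ((stepChar θ : ℂ) ^ k * latChar (x + Pi.single i 1) θ +
          (stepChar θ : ℂ) ^ k * latChar (x - Pi.single i 1) θ) := by
      intro θ
      rw [pow_succ, mul_assoc, ← sum_latChar]
      simp only [← mul_add, ← Finset.mul_sum]
      ring
    simp only [h1]
    rw [integral_const_mul, integral_finsetSum]
    swap
    · exact fun i _ => (integrable_char _ _).add (integrable_char _ _)
    simp only [integral_add (integrable_char _ _) (integrable_char _ _), ih, walkP]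
    push_cast
    simp only [← mul_add, ← Finset.mul_sum]
    ring

lemma integral_exp_neg_sin_sq_le {a : ℝ} (ha : 0 < a) :
    ∫ t, Real.exp (-a * Real.sin t ^ 2) ∂periodMeasure ≤ 3 * (Real.pi ^ 2 / 2) / √a := by
  set b := a * (2 / Real.pi) ^ 2 with hb
  have hpi := Real.pi_pos
  have hb0 : 0 < b := by positivity
  have key : ∀ t : ℝ, |t| ≤ Real.pi / 2 → Real.exp (-a * Real.sin t ^ 2) ≤ Real.exp (-b * t ^ 2) := by
    intro t ht
    have h1 := Real.mul_abs_le_abs_sin ht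
    have h2 : (2 / Real.pi * |t|) ^ 2 ≤ |Real.sin t| ^ 2 := by gcongr
    rw [mul_pow, sq_abs, sq_abs] at h2
    rw [Real.exp_le_exp, hb]
    nlinarith
  have hi0 : Integrable (fun t : ℝ => Real.exp (-b * t ^ 2)) := integrable_exp_neg_mul_sq hb0
  have hi1 : Integrable (fun t : ℝ => Real.exp (-b * (t - Real.pi) ^ 2)) := hi0.comp_sub_right _
  have hi2 : Integrable (fun t : ℝ => Real.exp (-b * (t + Real.pi) ^ 2)) := hi0.comp_add_right _
  have bound : ∀ t ∈ Set.Ioc (-Real.pi) Real.pi, Real.exp (-a * Real.sin t ^ 2) ≤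
      Real.exp (-b * t ^ 2) + Real.exp (-b * (t - Real.pi) ^ 2) + Real.exp (-b * (t + Real.pi) ^ 2) := by
    intro t ht
    have p0 := Real.exp_pos (-b * t ^ 2)
    have p1 := Real.exp_pos (-b * (t - Real.pi) ^ 2)
    have p2 := Real.exp_pos (-b * (t + Real.pi) ^ 2)
    rcases le_or_gt |t| (Real.pi / 2) with h | h
    · linarith [key t h]
    · rcases lt_abs.1 h with h | h
      · have := key (t - Real.pi) (abs_le.2 ⟨by linarith, by linarith [ht.2]⟩)
        rw [Real.sin_sub_pi, neg_sq] at this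
        linarith
      · have := key (t + Real.pi) (abs_le.2 ⟨by linarith [ht.1], by linarith⟩)
        rw [Real.sin_add_pi, neg_sq] at this
        linarith
  calc ∫ t, Real.exp (-a * Real.sin t ^ 2) ∂periodMeasure
      ≤ ∫ t in Set.Ioc (-Real.pi) Real.pi, (Real.exp (-b * t ^ 2) +
          Real.exp (-b * (t - Real.pi) ^ 2) + Real.exp (-b * (t + Real.pi) ^ 2)) := by
        refine setIntegral_mono_on ?_ ((hi0.add hi1).add hi2).integrableOn measurableSet_Ioc bound
        exact (Continuous.integrableOn_Icc (by fun_prop)).mono_set Set.Ioc_subset_Icc_self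
    _ ≤ ∫ t, (Real.exp (-b * t ^ 2) +
          Real.exp (-b * (t - Real.pi) ^ 2) + Real.exp (-b * (t + Real.pi) ^ 2)) :=
        setIntegral_le_integral ((hi0.add hi1).add hi2) (ae_of_all _ fun t => by positivity)
    _ = 3 * √(Real.pi / b) := by
        have e : ∀ c : ℝ, ∫ t : ℝ, Real.exp (-b * (t + c) ^ 2) = √(Real.pi / b) := fun c => by
          rw [← integral_gaussian b]
          exact integral_add_right_eq_self (fun t : ℝ => Real.exp (-b * t ^ 2)) c
        rw [integral_add (by exact hi0.add hi1) hi2, integral_add hi0 hi1, e Real.pi]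
        have e1 := e (-Real.pi)
        have e0 := e 0
        simp only [← sub_eq_add_neg, add_zero] at e1 e0
        rw [e1, e0]
        ring
    _ ≤ _ := by
        rw [mul_div_assoc]
        gcongr
        have h4 : Real.pi / b = (Real.pi ^ 3 / 4) / a := by
          rw [hb]
          field_simp
          norm_num
        rw [h4, Real.sqrt_div (by positivity)]
        gcongr
        rw [Real.sqrt_le_left (by positivity)]
        nlinarith [Real.pi_gt_three, pow_pos hpi 3]

lemma walkP_le {d : ℕ} (hd : d ≠ 0) {k : ℕ} (hk : k ≠ 0) (x : Fin d → ℤ) :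
    walkP k x ≤ (3 * (Real.pi ^ 2 / 2) * √(2 * d)) ^ d * (√k)⁻¹ ^ d := by
  have hpi := Real.pi_pos
  have hd0 : (0 : ℝ) < d := by positivity
  have hk0 : (0 : ℝ) < k := by positivity
  set a : ℝ := k / (2 * d) with ha
  have ha0 : 0 < a := by positivity
  have h1 : (2 * Real.pi) ^ d * walkP k x ≤ (3 * (Real.pi ^ 2 / 2) / √a) ^ d := by
    calc (2 * Real.pi) ^ d * walkP k x = ‖(2 * Real.pi : ℂ) ^ d * walkP k x‖ := by
          rw [norm_mul, norm_pow, norm_mul, Complex.norm_real, Complex.norm_real,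
            Real.norm_of_nonneg (walkP_nonneg k x), Real.norm_of_nonneg hpi.le]
          simp
      _ = ‖∫ θ, (stepChar θ : ℂ) ^ k * latChar x θ ∂(Measure.pi fun _ : Fin d => periodMeasure)‖ := by
          rw [walkP_fourier hd]
      _ ≤ ∫ θ, ∏ i, Real.exp (-a * Real.sin (θ i) ^ 2) ∂(Measure.pi fun _ : Fin d => periodMeasure) := by
          refine norm_integral_le_of_norm_le (integrable_torus (C := 1) (by fun_prop) fun θ => ?_)
            (ae_of_all _ fun θ => ?_)
          · rw [norm_prod]
            refine Finset.prod_le_one (fun i _ => norm_nonneg _) fun i _ => ?_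
            rw [Real.norm_eq_abs, Real.abs_exp, Real.exp_le_one_iff, neg_mul, neg_nonpos]
            positivity
          · rw [norm_mul, norm_latChar, mul_one, norm_pow, Complex.norm_real, Real.norm_eq_abs,
              ← Real.exp_sum]
            refine (pow_le_pow_left₀ (abs_nonneg _) (abs_stepChar_le hd θ) k).trans_eq ?_
            rw [← Real.exp_nat_mul, ← Finset.mul_sum, ha]
            congr 1
            field_simp
      _ = (∫ t, Real.exp (-a * Real.sin t ^ 2) ∂periodMeasure) ^ d := by
          rw [integral_fintype_prod_eq_pow (𝕜 := ℝ) (ι := Fin d)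
            (fun t => Real.exp (-a * Real.sin t ^ 2)), Fintype.card_fin]
      _ ≤ _ := by
          exact pow_le_pow_left₀ (integral_nonneg fun t => (Real.exp_pos _).le)
            (integral_exp_neg_sin_sq_le ha0) d
  have h2 : walkP k x ≤ (2 * Real.pi) ^ d * walkP k x :=
    le_mul_of_one_le_left (walkP_nonneg k x) (one_le_pow₀ (by linarith [Real.pi_gt_three]))
  refine (h2.trans h1).trans_eq ?_
  rw [← mul_pow, ha, Real.sqrt_div hk0.le]
  congr 1
  field_simp

lemma sum_walkP_le_one {d : ℕ} (hd : d ≠ 0) (D : Finset (Fin d → ℤ)) (k : ℕ) (x : Fin d → ℤ) :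
    ∑ z ∈ D, walkP k (x - z) ≤ 1 := by
  have h := (Equiv.hasSum_iff (f := walkP k) (Equiv.subLeft x)).2 (hasSum_walkP hd k)
  exact sum_le_hasSum D (fun z _ => walkP_nonneg k _) h

lemma inv_sqrt_cube_le {k : ℝ} (hk : 1 ≤ k) :
    (√(k + 1))⁻¹ ^ 3 ≤ 2 * ((√k)⁻¹ - (√(k + 1))⁻¹) := by
  have ha : 0 < √k := Real.sqrt_pos.2 (by linarith)
  have hab : √k ≤ √(k + 1) := Real.sqrt_le_sqrt (by linarith)
  have ha2 : √k ^ 2 = k := Real.sq_sqrt (by linarith)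
  have hb2 : √(k + 1) ^ 2 = k + 1 := Real.sq_sqrt (by linarith)
  set a := √k
  set b := √(k + 1)
  have hb : 0 < b := by linarith
  have e : a⁻¹ - b⁻¹ = 1 / (a * b * (a + b)) := by
    have : (b - a) * (a + b) = 1 := by linarith [mul_comm a b, sq a, sq b, show (b - a) * (a + b) = b ^ 2 - a ^ 2 by ring]
    field_simp
    linarith
  rw [e, inv_pow, mul_one_div, ← one_div, div_le_div_iff₀ (by positivity) (by positivity)]
  have h1 : a * b ≤ b * b := by gcongr
  have h2 : a * b * (a + b) ≤ b * b * (b + b) := by gcongr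
  linarith [show b * b * (b + b) = 2 * b ^ 3 by ring]

lemma exists_sum_walkP_le {d : ℕ} (hd : 3 ≤ d) : ∃ C : ℝ, 0 < C ∧
    ∀ (D : Finset (Fin d → ℤ)), D.Nonempty → ∀ (n : ℕ) (x : Fin d → ℤ),
      ∑ k ∈ Finset.range n, ∑ z ∈ D, walkP k (x - z) ≤ C * (D.card : ℝ) ^ (2 / d : ℝ) := by
  have hd0 : d ≠ 0 := by omega
  have hd1 : (0 : ℝ) < d := by positivity
  set C₀ : ℝ := (3 * (Real.pi ^ 2 / 2) * √(2 * d)) ^ d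
  have hC₀ : 0 ≤ C₀ := by positivity
  refine ⟨2 * (2 + 2 * C₀), by positivity, fun D hD n x => ?_⟩
  have hN : (1 : ℝ) ≤ D.card := by exact_mod_cast hD.card_pos
  set N : ℝ := (D.card : ℝ)
  have hr : 1 ≤ N ^ (2 / d : ℝ) := Real.one_le_rpow hN (by positivity)
  set K : ℕ := ⌈N ^ (2 / d : ℝ)⌉₊
  have hK1 : N ^ (2 / d : ℝ) ≤ K := Nat.le_ceil _
  have hK2 : (K : ℝ) ≤ N ^ (2 / d : ℝ) + 1 := (Nat.ceil_lt_add_one (by positivity)).le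
  have hK : (1 : ℝ) ≤ K := hr.trans hK1
  have hNK : N ≤ √K ^ d := by
    calc N = (N ^ (2 / d : ℝ)) ^ (d / 2 : ℝ) := by
          rw [← Real.rpow_mul (by positivity)]
          rw [show (2 / d * (d / 2) : ℝ) = 1 by field_simp, Real.rpow_one]
      _ ≤ (K : ℝ) ^ (d / 2 : ℝ) := by gcongr
      _ = √K ^ d := by
          rw [Real.sqrt_eq_rpow, ← Real.rpow_natCast, ← Real.rpow_mul (by positivity)]
          congr 1
          ring
  have hf : ∀ k : ℕ, K ≤ k → ∑ z ∈ D, walkP k (x - z) ≤ C₀ * √K ^ 3 * (√k)⁻¹ ^ 3 := by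
    intro k hk
    have hk' : (K : ℝ) ≤ k := by exact_mod_cast hk
    have hkne : k ≠ 0 := by
      have : 1 ≤ K := by exact_mod_cast hK
      omega
    have hsk : 0 < √(k : ℝ) := Real.sqrt_pos.2 (by linarith)
    have hq : √(K : ℝ) * (√k)⁻¹ ≤ 1 := by
      rw [← div_eq_mul_inv, div_le_one hsk]
      exact Real.sqrt_le_sqrt hk'
    calc ∑ z ∈ D, walkP k (x - z) ≤ ∑ z ∈ D, C₀ * (√k)⁻¹ ^ d :=
          Finset.sum_le_sum fun z _ => walkP_le hd0 hkne _
      _ = N * (C₀ * (√k)⁻¹ ^ d) := by rw [Finset.sum_const, nsmul_eq_mul]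
      _ ≤ √K ^ d * (C₀ * (√k)⁻¹ ^ d) := by gcongr
      _ = C₀ * (√K * (√k)⁻¹) ^ d := by rw [mul_pow]; ring
      _ ≤ C₀ * (√K * (√k)⁻¹) ^ 3 := by
          gcongr C₀ * ?_
          exact pow_le_pow_of_le_one (by positivity) hq hd
      _ = _ := by rw [mul_pow]; ring
  have hsum : ∀ m : ℕ, ∑ k ∈ Finset.range (K + 1 + m), ∑ z ∈ D, walkP k (x - z) ≤
      K + 1 + C₀ * √K ^ 3 * (2 * ((√K)⁻¹ - (√(K + m : ℝ))⁻¹)) := by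
    intro m
    induction m with
    | zero =>
      refine (Finset.sum_le_sum fun k _ => sum_walkP_le_one hd0 D k x).trans ?_
      simp
    | succ m ih =>
      rw [← add_assoc, Finset.sum_range_succ]
      have h1 := hf (K + 1 + m) (by omega)
      have h2 : (√((K + 1 + m : ℕ) : ℝ))⁻¹ ^ 3 ≤
          2 * ((√(K + m : ℝ))⁻¹ - (√((K + m : ℝ) + 1))⁻¹) := by
        have := inv_sqrt_cube_le (k := K + m) (by linarith [m.cast_nonneg (α := ℝ)])
        push_cast
        rwa [show (K + 1 + m : ℝ) = K + m + 1 by ring]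
      have h3 := mul_le_mul_of_nonneg_left h2 (show 0 ≤ C₀ * √(K : ℝ) ^ 3 by positivity)
      push_cast
      rw [show (K + (m + 1) : ℝ) = K + m + 1 by ring]
      linarith
  have hmono : ∑ k ∈ Finset.range n, ∑ z ∈ D, walkP k (x - z) ≤
      ∑ k ∈ Finset.range (K + 1 + n), ∑ z ∈ D, walkP k (x - z) :=
    Finset.sum_le_sum_of_subset_of_nonneg (Finset.range_mono (by omega))
      fun k _ _ => Finset.sum_nonneg fun z _ => walkP_nonneg k _
  have hsK : 0 < √(K : ℝ) := Real.sqrt_pos.2 (by linarith)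
  have hs3 : √(K : ℝ) ^ 3 * (√K)⁻¹ = K := by
    rw [pow_succ, mul_assoc, mul_inv_cancel₀ hsK.ne', mul_one, Real.sq_sqrt (by positivity)]
  have hlast : C₀ * √K ^ 3 * (2 * ((√K)⁻¹ - (√(K + n : ℝ))⁻¹)) ≤ 2 * C₀ * K := by
    calc C₀ * √K ^ 3 * (2 * ((√K)⁻¹ - (√(K + n : ℝ))⁻¹)) ≤ C₀ * √K ^ 3 * (2 * (√K)⁻¹) := by
          gcongr
          exact sub_le_self _ (by positivity)
      _ = 2 * C₀ * (√(K : ℝ) ^ 3 * (√K)⁻¹) := by ring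
      _ = _ := by rw [hs3]
  calc _ ≤ (K : ℝ) + 1 + 2 * C₀ * K := by linarith [hsum n]
    _ ≤ (2 + 2 * C₀) * K := by linarith
    _ ≤ (2 + 2 * C₀) * (2 * N ^ (2 / d : ℝ)) := by
        gcongr
        linarith
    _ = _ := by ring

/-- The Green function of simple random walk. -/
noncomputable def greenFn {d : ℕ} (x : Fin d → ℤ) : ℝ := ∑' k, walkP k x

lemma exists_greenFn_bound {d : ℕ} (hd : 3 ≤ d) :
    (∀ x : Fin d → ℤ, Summable fun k => walkP k x) ∧ ∃ G : ℝ, ∀ x : Fin d → ℤ, greenFn x ≤ G := by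
  obtain ⟨C, -, hC⟩ := exists_sum_walkP_le hd
  have h : ∀ (x : Fin d → ℤ) (n : ℕ), ∑ k ∈ Finset.range n, walkP k x ≤ C := by
    intro x n
    simpa using hC {0} (Finset.singleton_nonempty _) n x
  exact ⟨fun x => summable_of_sum_range_le (fun k => walkP_nonneg k x) (h x), C,
    fun x => Real.tsum_le_of_sum_range_le (fun k => walkP_nonneg k x) (h x)⟩

lemma greenFn_nonneg {d : ℕ} (x : Fin d → ℤ) : 0 ≤ greenFn x :=
  tsum_nonneg fun k => walkP_nonneg k x

lemma le_sum_greenFn {d : ℕ} (hd : 3 ≤ d) (R : ℕ) :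
    (R : ℝ) ≤ ∑ x ∈ Finset.Icc (fun _ : Fin d => -(R : ℤ)) (fun _ => (R : ℤ)), greenFn x := by
  calc (R : ℝ) = ∑ k ∈ Finset.range R,
        ∑ x ∈ Finset.Icc (fun _ : Fin d => -(R : ℤ)) (fun _ => (R : ℤ)), walkP k x := by
        rw [Finset.sum_congr rfl fun k hk =>
          sum_Icc_walkP (by omega) (Finset.mem_range.1 hk).le]
        simp
    _ = ∑ x ∈ Finset.Icc (fun _ : Fin d => -(R : ℤ)) (fun _ => (R : ℤ)),
        ∑ k ∈ Finset.range R, walkP k x := Finset.sum_comm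
    _ ≤ _ := Finset.sum_le_sum fun x _ =>
        ((exists_greenFn_bound hd).1 x).sum_le_tsum _ fun k _ => walkP_nonneg k x

lemma walkP_succ {d : ℕ} (k : ℕ) (x y : Fin d → ℤ) :
    walkP (k + 1) (x - y) = ((latNbrs x).card : ℝ)⁻¹ * ∑ z ∈ latNbrs x, walkP k (z - y) := by
  rw [card_latNbrs, sum_latNbrs, walkP]
  push_cast
  simp only [add_sub_right_comm, sub_right_comm]

lemma hitP_nonneg {d : ℕ} (B : Set (Fin d → ℤ)) (n : ℕ) (x y : Fin d → ℤ) :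
    0 ≤ hitP latNbrs B n x y := by
  induction n generalizing x with
  | zero => unfold hitP; split_ifs <;> norm_num
  | succ n ih =>
    unfold hitP
    split_ifs
    · norm_num
    · norm_num
    · exact mul_nonneg (by positivity) (Finset.sum_nonneg fun z _ => ih z)

lemma hitP_self {d : ℕ} {B : Set (Fin d → ℤ)} (n : ℕ) {x : Fin d → ℤ} (hx : x ∈ B) :
    hitP latNbrs B n x x = 1 := by
  cases n <;> simp [hitP, hx]

lemma ite_le_sum_walkP {d : ℕ} (n : ℕ) (x y : Fin d → ℤ) :
    (if x = y then 1 else 0 : ℝ) ≤ ∑ k ∈ Finset.range (n + 1), walkP k (x - y) := by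
  have h : walkP 0 (x - y) = if x = y then 1 else 0 := by simp [walkP, sub_eq_zero]
  rw [Finset.sum_range_succ', h]
  linarith [Finset.sum_nonneg fun k (_ : k ∈ Finset.range n) => walkP_nonneg (k + 1) (x - y)]

lemma hitP_le_sum_walkP {d : ℕ} (B : Set (Fin d → ℤ)) (n : ℕ) (x y : Fin d → ℤ) :
    hitP latNbrs B n x y ≤ ∑ k ∈ Finset.range (n + 1), walkP k (x - y) := by
  induction n generalizing x with
  | zero =>
    refine le_trans ?_ (ite_le_sum_walkP 0 x y)
    unfold hitP
    split_ifs <;> simp_all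
  | succ n ih =>
    by_cases hx : x ∈ B
    · rw [hitP, if_pos hx]
      convert ite_le_sum_walkP (n + 1) x y
    · rw [hitP, if_neg hx, Finset.sum_range_succ']
      have h1 : ∑ k ∈ Finset.range (n + 1), walkP (k + 1) (x - y) = ((latNbrs x).card : ℝ)⁻¹ *
          ∑ z ∈ latNbrs x, ∑ k ∈ Finset.range (n + 1), walkP k (z - y) := by
        rw [Finset.sum_comm, Finset.mul_sum]
        exact Finset.sum_congr rfl fun k _ => walkP_succ k x y
      rw [h1]
      refine le_add_of_le_of_nonneg ?_ (walkP_nonneg _ _)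
      gcongr with z
      exact ih z

lemma hitP_le_greenFn {d : ℕ} (hd : 3 ≤ d) (B : Set (Fin d → ℤ)) (n : ℕ) (x y : Fin d → ℤ) :
    hitP latNbrs B n x y ≤ greenFn (x - y) :=
  (hitP_le_sum_walkP B n x y).trans
    (((exists_greenFn_bound hd).1 _).sum_le_tsum _ fun k _ => walkP_nonneg k _)

lemma hitMeas_le_greenFn {d : ℕ} (hd : 3 ≤ d) (B : Set (Fin d → ℤ)) (x y : Fin d → ℤ) :
    hitMeas latNbrs B x y ≤ greenFn (x - y) :=
  ciSup_le fun n => hitP_le_greenFn hd B n x y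

lemma hitP_le_hitMeas {d : ℕ} (hd : 3 ≤ d) (B : Set (Fin d → ℤ)) (n : ℕ) (x y : Fin d → ℤ) :
    hitP latNbrs B n x y ≤ hitMeas latNbrs B x y :=
  le_ciSup (f := fun n => hitP latNbrs B n x y)
    ⟨greenFn (x - y), by rintro _ ⟨m, rfl⟩; exact hitP_le_greenFn hd B m x y⟩ n

lemma hitMeas_nonneg {d : ℕ} (B : Set (Fin d → ℤ)) (x y : Fin d → ℤ) :
    0 ≤ hitMeas latNbrs B x y :=
  Real.iSup_nonneg fun n => hitP_nonneg B n x y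

/-- The walk started off `A` spends no time in `A` before hitting the outer boundary of `A`. -/
lemma sum_walkP_le_hitP {d : ℕ} (A : Finset (Fin d → ℤ)) {M : ℝ} (hM : 0 ≤ M)
    (h : ∀ (n : ℕ) (x : Fin d → ℤ), ∑ k ∈ Finset.range n, ∑ z ∈ A, walkP k (x - z) ≤ M)
    (n : ℕ) {x : Fin d → ℤ} (hx : x ∉ A) :
    ∑ k ∈ Finset.range (n + 1), ∑ z ∈ A, walkP k (x - z) ≤
      M * ∑ z ∈ bdryF latNbrs A, hitP latNbrs (↑(bdryF latNbrs A)) n x z := by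
  set B := bdryF latNbrs A
  have hbdry : ∀ (n : ℕ), ∀ w ∈ B, ∑ k ∈ Finset.range (n + 1), ∑ z ∈ A, walkP k (w - z) ≤
      M * ∑ z ∈ B, hitP latNbrs (↑B) n w z := by
    intro n w hw
    refine (h _ _).trans (le_mul_of_one_le_right hM ?_)
    rw [← hitP_self (B := (↑B : Set (Fin d → ℤ))) n (Finset.mem_coe.2 hw)]
    exact Finset.single_le_sum (f := fun z => hitP latNbrs (↑B) n w z)
      (fun z _ => hitP_nonneg _ n w z) hw
  have hzero : ∀ x ∉ A, ∑ z ∈ A, walkP 0 (x - z) = 0 := fun x hx =>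
    Finset.sum_eq_zero fun z hz => by
      rw [walkP, if_neg]
      rw [sub_eq_zero]
      rintro rfl
      exact hx hz
  induction n generalizing x with
  | zero =>
    rw [zero_add, Finset.sum_range_one, hzero x hx]
    exact mul_nonneg hM (Finset.sum_nonneg fun z _ => hitP_nonneg _ _ _ _)
  | succ n ih =>
    by_cases hxB : x ∈ B
    · exact hbdry _ x hxB
    have hstep : ∀ w ∈ latNbrs x, ∑ k ∈ Finset.range (n + 1), ∑ z ∈ A, walkP k (w - z) ≤
        M * ∑ z ∈ B, hitP latNbrs (↑B) n w z := fun w hw =>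
      ih fun hwA => hxB (Finset.mem_sdiff.2 ⟨Finset.mem_biUnion.2 ⟨w, hwA, latNbrs_symm hw⟩, hx⟩)
    have h1 : ∑ k ∈ Finset.range (n + 1), ∑ z ∈ A, walkP (k + 1) (x - z) =
        ((latNbrs x).card : ℝ)⁻¹ *
          ∑ w ∈ latNbrs x, ∑ k ∈ Finset.range (n + 1), ∑ z ∈ A, walkP k (w - z) := by
      simp only [walkP_succ, ← Finset.mul_sum]
      congr 1
      rw [Finset.sum_comm (s := latNbrs x)]
      exact Finset.sum_congr rfl fun k _ => Finset.sum_comm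
    have h2 : ∑ z ∈ B, hitP latNbrs (↑B) (n + 1) x z = ((latNbrs x).card : ℝ)⁻¹ *
        ∑ w ∈ latNbrs x, ∑ z ∈ B, hitP latNbrs (↑B) n w z := by
      have hxB' : x ∉ (↑B : Set (Fin d → ℤ)) := hxB
      simp only [hitP, if_neg hxB', ← Finset.mul_sum]
      rw [Finset.sum_comm]
    rw [Finset.sum_range_succ', hzero x hx, add_zero, h1, h2, mul_left_comm, Finset.mul_sum (a := M)]
    gcongr with w hw
    exact hstep w hw

/-- A bounded nonnegative function on the lattice with infinite total mass is not contracted by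
averaging over finitely many translates. -/
lemma exists_translates_sum_gt {d : ℕ} {g : (Fin d → ℤ) → ℝ} {G : ℝ} (hg0 : ∀ x, 0 ≤ g x)
    (hgG : ∀ x, g x ≤ G)
    (hg : ∀ R : ℕ, (R : ℝ) ≤
      ∑ x ∈ Finset.Icc (fun _ : Fin d => -(R : ℤ)) (fun _ => (R : ℤ)), g x)
    (A K : Finset (Fin d → ℤ)) (hA : A.Nonempty) (y : Fin d → ℤ) :
    ∃ x ∉ K, A.card * g (x - y) < 2 * ∑ z ∈ A, g (x - z) := by
  by_contra! hcon
  set ball : ℕ → Finset (Fin d → ℤ) := fun R => Finset.Icc (fun _ => -(R : ℤ)) (fun _ => (R : ℤ))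
    with hball
  set s : ℕ → ℝ := fun R => ∑ x ∈ ball R, g x with hs
  have hN : (0 : ℝ) < A.card := by exact_mod_cast hA.card_pos
  have hG : 0 ≤ G := (hg0 0).trans (hgG 0)
  have hmem : ∀ (R : ℕ) (x : Fin d → ℤ), x ∈ ball R ↔ ∀ i, |x i| ≤ R := by
    intro R x
    simp only [hball, Finset.mem_Icc, Pi.le_def, abs_le, forall_and]
  obtain ⟨L, hL⟩ : ∃ L : ℕ, ∀ z ∈ A, ∀ i, |(y - z) i| ≤ L := by
    refine ⟨∑ z ∈ A, ∑ i, ((y - z) i).natAbs, fun z hz i => ?_⟩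
    have h1 := Finset.single_le_sum (f := fun i => ((y - z) i).natAbs) (fun _ _ => Nat.zero_le _)
      (Finset.mem_univ i)
    have h2 := Finset.single_le_sum (f := fun z => ∑ i, ((y - z) i).natAbs)
      (fun _ _ => Nat.zero_le _) hz
    rw [Int.abs_eq_natAbs]
    exact_mod_cast h1.trans h2
  have hdouble : ∀ R, 2 * s R ≤ s (R + L) + 2 * (K.card * G) := by
    intro R
    have hlow : ∀ z ∈ A, s R ≤ ∑ v ∈ ball (R + L), g (v + y - z) := by
      intro z hz
      have : ∑ v ∈ ball (R + L), g (v + y - z) =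
          ∑ x ∈ (ball (R + L)).map (Equiv.addRight (y - z)).toEmbedding, g x := by
        simp [Finset.sum_map, add_sub_assoc]
      rw [this]
      refine Finset.sum_le_sum_of_subset_of_nonneg (fun x hx => ?_) fun x _ _ => hg0 x
      rw [Finset.mem_map]
      refine ⟨x - (y - z), (hmem _ _).2 fun i => ?_, by simp⟩
      have h1 := (hmem _ _).1 hx i
      have h2 := hL z hz i
      push_cast
      exact (abs_sub _ _).trans (add_le_add h1 h2)
    have hup : ∀ v, 2 * ∑ z ∈ A, g (v + y - z) ≤
        A.card * g v + if v + y ∈ K then 2 * (A.card * G) else 0 := by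
      intro v
      split_ifs with h
      · have h1 : ∑ z ∈ A, g (v + y - z) ≤ A.card * G := by
          rw [← nsmul_eq_mul]
          exact Finset.sum_le_card_nsmul _ _ _ fun z _ => hgG _
        have := mul_nonneg hN.le (hg0 v)
        linarith
      · have := hcon (v + y) h
        rw [add_sub_cancel_right] at this
        linarith
    have hK : ∑ v ∈ ball (R + L), (if v + y ∈ K then 2 * (A.card * G) else 0) ≤
        K.card * (2 * (A.card * G)) := by
      rw [← Finset.sum_filter, Finset.sum_const, nsmul_eq_mul]
      refine mul_le_mul_of_nonneg_right (Nat.cast_le.2 ?_) (by positivity)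
      refine Finset.card_le_card_of_injOn (· + y) (fun v hv => ?_) fun _ _ _ _ h => by simpa using h
      exact (Finset.mem_filter.1 hv).2
    have h1 : (A.card : ℝ) * s R ≤ ∑ v ∈ ball (R + L), ∑ z ∈ A, g (v + y - z) := by
      rw [Finset.sum_comm, ← nsmul_eq_mul]
      exact Finset.card_nsmul_le_sum _ _ _ hlow
    have h2 := Finset.sum_le_sum fun v (_ : v ∈ ball (R + L)) => hup v
    rw [Finset.sum_add_distrib, ← Finset.mul_sum, ← Finset.mul_sum] at h2
    have h3 : (A.card : ℝ) * (2 * s R) ≤ A.card * (s (R + L) + 2 * (K.card * G)) := by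
      calc (A.card : ℝ) * (2 * s R) = 2 * (A.card * s R) := by ring
        _ ≤ A.card * s (R + L) + K.card * (2 * (A.card * G)) := by linarith
        _ = _ := by ring
    exact le_of_mul_le_mul_left h3 hN
  obtain ⟨r, hr⟩ := exists_nat_ge (2 * (K.card * G) + 1)
  have hgrow : ∀ j : ℕ, (2 : ℝ) ^ j + 2 * (K.card * G) ≤ s (r + j * L) := by
    intro j
    induction j with
    | zero =>
      have := hg r
      simp only [zero_mul, add_zero, pow_zero]
      linarith
    | succ j ih =>
      have := hdouble (r + j * L)
      rw [show r + (j + 1) * L = r + j * L + L by ring, pow_succ]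
      have : 0 ≤ 2 * (K.card * G) := by positivity
      linarith
  have hpoly : ∀ j : ℕ, s (r + j * L) ≤ (2 * (r + L) + 1 : ℝ) ^ d * G * ((j + 1 : ℕ) : ℝ) ^ d := by
    intro j
    have hcard : ((ball (r + j * L)).card : ℝ) = (2 * (r + j * L) + 1 : ℝ) ^ d := by
      have : (ball (r + j * L)).card = (2 * (r + j * L) + 1) ^ d := by
        simp only [hball, Pi.card_Icc, Int.card_Icc, Finset.prod_const, Finset.card_univ,
          Fintype.card_fin]
        congr 1
        omega
      rw [this]
      push_cast
      ring
    calc s (r + j * L) ≤ (ball (r + j * L)).card * G := by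
          rw [← nsmul_eq_mul]
          exact Finset.sum_le_card_nsmul _ _ _ fun x _ => hgG x
      _ = (2 * (r + j * L) + 1 : ℝ) ^ d * G := by rw [hcard]
      _ ≤ ((2 * (r + L) + 1 : ℝ) * ((j + 1 : ℕ) : ℝ)) ^ d * G := by
          gcongr
          push_cast
          nlinarith [mul_nonneg (r.cast_nonneg (α := ℝ)) (j.cast_nonneg (α := ℝ)),
            j.cast_nonneg (α := ℝ), L.cast_nonneg (α := ℝ)]
      _ = _ := by rw [mul_pow]; ring
  have hlim := ((tendsto_pow_const_div_const_pow_of_one_lt d (one_lt_two (α := ℝ))).comp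
    (tendsto_add_atTop_nat 1)).const_mul (2 * ((2 * (r + L) + 1 : ℝ) ^ d * G))
  rw [mul_zero] at hlim
  obtain ⟨j, hj⟩ := (hlim.eventually (gt_mem_nhds one_pos)).exists
  simp only [Function.comp] at hj
  rw [← mul_div_assoc, div_lt_one (by positivity), pow_succ] at hj
  have h1 := hgrow j
  have h2 := hpoly j
  have h3 : 0 ≤ 2 * (K.card * G) := by positivity
  linarith

lemma exists_harmonic_le {d : ℕ} (hd : 3 ≤ d) : ∃ C : ℝ, 0 < C ∧
    ∀ (A : Finset (Fin d → ℤ)), A.Nonempty → ∀ (y : Fin d → ℤ) (m : ℝ),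
      Tendsto (fun x => hitMeas latNbrs (↑(bdryF latNbrs A)) x y /
        ∑ z ∈ bdryF latNbrs A, hitMeas latNbrs (↑(bdryF latNbrs A)) x z) cofinite (𝓝 m) →
      m ≤ C * (A.card : ℝ) ^ (2 / d - 1 : ℝ) := by
  obtain ⟨C, hC0, hC⟩ := exists_sum_walkP_le hd
  obtain ⟨hsum, G, hG⟩ := exists_greenFn_bound hd
  refine ⟨2 * C, by positivity, fun A hA y m hm => ?_⟩
  have hN : (0 : ℝ) < A.card := by exact_mod_cast hA.card_pos
  set B := bdryF latNbrs A
  set M : ℝ := C * (A.card : ℝ) ^ (2 / d : ℝ) with hM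
  have hM0 : 0 < M := by positivity
  have hMN : 2 * C * (A.card : ℝ) ^ (2 / d - 1 : ℝ) = 2 * M / A.card := by
    rw [Real.rpow_sub hN, Real.rpow_one, hM]
    ring
  rw [hMN]
  by_contra! hlt
  have hev := hm.eventually (lt_mem_nhds hlt)
  rw [eventually_cofinite] at hev
  obtain ⟨x, hxK, hx⟩ := exists_translates_sum_gt (d := d) greenFn_nonneg hG (le_sum_greenFn hd) A
    (hev.toFinset ∪ A) hA y
  rw [Finset.mem_union, not_or, Set.Finite.mem_toFinset, Set.mem_ofPred_eq, not_not] at hxK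
  obtain ⟨hx1, hxA⟩ := hxK
  set H := ∑ z ∈ B, hitMeas latNbrs (↑B) x z
  have hH0 : 0 ≤ H := Finset.sum_nonneg fun z _ => hitMeas_nonneg _ _ _
  have hH : 0 < H := by
    rcases hH0.eq_or_lt with h | h
    · rw [← h, div_zero] at hx1
      have : 0 < 2 * M / A.card := by positivity
      linarith
    · exact h
  have hU : ∑ z ∈ A, greenFn (x - z) ≤ M * H := by
    have h1 : HasSum (fun k => ∑ z ∈ A, walkP k (x - z)) (∑ z ∈ A, greenFn (x - z)) :=
      hasSum_sum fun z _ => (hsum (x - z)).hasSum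
    rw [← h1.tsum_eq]
    refine Real.tsum_le_of_sum_range_le
      (fun k => Finset.sum_nonneg fun z _ => walkP_nonneg k _) fun n => ?_
    calc ∑ k ∈ Finset.range n, ∑ z ∈ A, walkP k (x - z)
        ≤ ∑ k ∈ Finset.range (n + 1), ∑ z ∈ A, walkP k (x - z) :=
          Finset.sum_le_sum_of_subset_of_nonneg (Finset.range_mono (Nat.le_succ n))
            fun k _ _ => Finset.sum_nonneg fun z _ => walkP_nonneg k _
      _ ≤ M * ∑ z ∈ B, hitP latNbrs (↑B) n x z :=
          sum_walkP_le_hitP A hM0.le (fun n x => hC A hA n x) n hxA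
      _ ≤ M * H :=
          mul_le_mul_of_nonneg_left
            (Finset.sum_le_sum fun z _ => hitP_le_hitMeas hd _ n x z) hM0.le
  rw [lt_div_iff₀ hH] at hx1
  have h2 := hx1.trans_le (hitMeas_le_greenFn hd _ x y)
  have h3 : A.card * (2 * M / A.card * H) < A.card * greenFn (x - y) := by gcongr
  rw [show A.card * (2 * M / A.card * H) = 2 * (M * H) by field_simp] at h3
  linarith

open Real in
/-- Exponential weight of a lattice point. -/
noncomputable def expWeight {d : ℕ} (x : Fin d → ℤ) : ENNReal :=
  ENNReal.ofReal (exp (∑ i, |(x i : ℝ)|))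

lemma expWeight_le_of_mem_latNbrs {d : ℕ} {x z : Fin d → ℤ} (h : z ∈ latNbrs x) :
    expWeight z ≤ ENNReal.ofReal (Real.exp 1) * expWeight x := by
  unfold expWeight
  rw [← ENNReal.ofReal_mul (Real.exp_pos 1).le, ← Real.exp_add]
  refine ENNReal.ofReal_le_ofReal (Real.exp_le_exp.2 ?_)
  have hs : ∀ i : Fin d, ∑ j, |((Pi.single i 1 : Fin d → ℤ) j : ℝ)| = 1 := by
    intro i
    rw [Finset.sum_eq_single i]
    · simp
    · intro j _ hj
      simp [hj]
    · simp
  obtain ⟨i, hi⟩ := mem_latNbrs.1 h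
  rw [← hs i, ← Finset.sum_add_distrib]
  refine Finset.sum_le_sum fun j _ => ?_
  rcases hi with rfl | rfl
  · rw [Pi.add_apply, Int.cast_add, add_comm]
    exact abs_add_le _ _
  · rw [Pi.sub_apply, Int.cast_sub, add_comm]
    exact abs_sub _ _

lemma sum_biUnion_le_sum {ι V : Type*} [DecidableEq V] (s : Finset ι)
    (t : ι → Finset V) (f : V → ENNReal) :
    ∑ y ∈ s.biUnion t, f y ≤ ∑ x ∈ s, ∑ y ∈ t x, f y := by
  classical
  induction s using Finset.induction_on with
  | empty => simp
  | insert x s hx ih =>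
    rw [Finset.biUnion_insert, Finset.sum_insert hx]
    refine le_trans ?_ (add_le_add_right ih _)
    rw [← Finset.sum_union_inter]
    exact le_self_add

lemma sum_bdryF_expWeight_le {d : ℕ} (A : Finset (Fin d → ℤ)) :
    ∑ y ∈ bdryF latNbrs A, expWeight y ≤
      ENNReal.ofReal (2 * d * Real.exp 1) * ∑ x ∈ A, expWeight x := by
  calc ∑ y ∈ bdryF latNbrs A, expWeight y ≤ ∑ y ∈ A.biUnion latNbrs, expWeight y :=
        Finset.sum_le_sum_of_subset Finset.sdiff_subset
    _ ≤ ∑ x ∈ A, ∑ y ∈ latNbrs x, expWeight y := by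
        exact sum_biUnion_le_sum _ _ _
    _ ≤ ∑ x ∈ A, ENNReal.ofReal (2 * d * Real.exp 1) * expWeight x := by
        refine Finset.sum_le_sum fun x _ => ?_
        refine (Finset.sum_le_card_nsmul _ _ _ fun y hy => expWeight_le_of_mem_latNbrs hy).trans_eq ?_
        rw [card_latNbrs, nsmul_eq_mul, ENNReal.ofReal_mul (by positivity), ← mul_assoc]
        congr 2
        rw [show (2 * d : ℝ) = ((2 * d : ℕ) : ℝ) by push_cast; rfl, ENNReal.ofReal_natCast]
    _ = _ := (Finset.mul_sum _ _ _).symm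

lemma ofReal_exp_le_expWeight {d : ℕ} {x : Fin d → ℤ} {R : ℝ} (h : R ≤ eunorm x) :
    ENNReal.ofReal (Real.exp R) ≤ expWeight x := by
  refine ENNReal.ofReal_le_ofReal (Real.exp_le_exp.2 (h.trans ?_))
  unfold eunorm
  rw [Real.sqrt_le_left (Finset.sum_nonneg fun i _ => abs_nonneg _)]
  simp only [← sq_abs ((x _ : ℤ) : ℝ)]
  exact Finset.sum_sq_le_sq_sum_of_nonneg fun i _ => abs_nonneg _

lemma exists_lt_eunorm_of_lt_radE {d : ℕ} {A : Finset (Fin d → ℤ)} {R : ℝ} (hR : 0 ≤ R)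
    (h : R < radE A) : ∃ x ∈ A, R < eunorm x := by
  by_contra! hcon
  exact h.not_ge (Real.iSup_le (fun x => Real.iSup_le (hcon x) hR) hR)

/-- One step of a growth process whose new site is chosen with conditional law `w`
given the current cluster. -/
lemma tsum_growth_step_le {V Ω : Type*} [Countable V] [DecidableEq V] [MeasurableSpace Ω]
    (P : Measure Ω) (E E' : Ω → Finset V) (Y : Ω → V) (bd : Finset V → Finset V)
    (w : Finset V → V → ENNReal) (a : V → ENNReal) (c : ENNReal) (n : ℕ)
    (hcard : ∀ ω, (E ω).card = n)
    (hE' : ∀ ω, E' ω = insert (Y ω) (E ω)) (hY : ∀ ω, Y ω ∈ bd (E ω))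
    (hbd : ∀ A, ∀ y ∈ bd A, y ∉ A)
    (hlaw : ∀ A, ∀ y ∈ bd A, P {ω | E ω = A ∧ Y ω = y} = w A y * P {ω | E ω = A})
    (hw : ∀ A, ∑ y ∈ bd A, w A y ≤ 1)
    (hc : ∀ A, A.card = n → ∑ y ∈ bd A, w A y * a y ≤ c * ∑ x ∈ A, a x) :
    ∑' A, P {ω | E' ω = A} * ∑ x ∈ A, a x ≤ (1 + c) * ∑' A, P {ω | E ω = A} * ∑ x ∈ A, a x := by
  have hstep : ∀ A', P {ω | E' ω = A'} ≤
      ∑' A, ∑ y ∈ bd A, if A' = insert y A then w A y * P {ω | E ω = A} else 0 := by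
    intro A'
    calc P {ω | E' ω = A'} ≤ P (⋃ A, ⋃ y ∈ bd A, {ω | A' = insert y A ∧ E ω = A ∧ Y ω = y}) := by
          refine measure_mono fun ω hω => ?_
          simp only [Set.mem_iUnion]
          exact ⟨E ω, Y ω, hY ω, by rw [← hE' ω]; exact hω.symm, rfl, rfl⟩
      _ ≤ ∑' A, ∑ y ∈ bd A, P {ω | A' = insert y A ∧ E ω = A ∧ Y ω = y} :=
          (measure_iUnion_le _).trans
            (ENNReal.tsum_le_tsum fun A => measure_biUnion_finset_le _ _)
      _ ≤ _ := by
          refine ENNReal.tsum_le_tsum fun A => Finset.sum_le_sum fun y hy => ?_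
          split_ifs with h
          · simp only [h, true_and]
            exact (hlaw A y hy).le
          · simp [h]
  calc ∑' A', P {ω | E' ω = A'} * ∑ x ∈ A', a x
      ≤ ∑' A', ∑' A, ∑ y ∈ bd A,
          (if A' = insert y A then w A y * P {ω | E ω = A} * ∑ x ∈ A', a x else 0) := by
        refine ENNReal.tsum_le_tsum fun A' => ?_
        refine (mul_le_mul_left (hstep A') _).trans_eq ?_
        rw [← ENNReal.tsum_mul_right]
        simp only [Finset.sum_mul, ite_mul, zero_mul]
    _ = ∑' A, ∑ y ∈ bd A, w A y * P {ω | E ω = A} * ∑ x ∈ insert y A, a x := by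
        rw [ENNReal.tsum_comm]
        refine tsum_congr fun A => ?_
        rw [Summable.tsum_finsetSum fun _ _ => ENNReal.summable]
        refine Finset.sum_congr rfl fun y _ => ?_
        rw [tsum_eq_single (insert y A) fun A' h => if_neg h, if_pos rfl]
    _ ≤ ∑' A, (1 + c) * (P {ω | E ω = A} * ∑ x ∈ A, a x) := by
        refine ENNReal.tsum_le_tsum fun A => ?_
        by_cases hA : A.card = n
        · calc ∑ y ∈ bd A, w A y * P {ω | E ω = A} * ∑ x ∈ insert y A, a x
              = P {ω | E ω = A} * ((∑ y ∈ bd A, w A y * a y) +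
                  (∑ y ∈ bd A, w A y) * ∑ x ∈ A, a x) := by
                rw [Finset.sum_mul, ← Finset.sum_add_distrib, Finset.mul_sum]
                refine Finset.sum_congr rfl fun y hy => ?_
                rw [Finset.sum_insert (hbd A y hy)]
                ring
            _ ≤ P {ω | E ω = A} * (c * (∑ x ∈ A, a x) + 1 * ∑ x ∈ A, a x) := by
                gcongr
                · exact hc A hA
                · exact hw A
            _ = _ := by ring
        · have : {ω | E ω = A} = ∅ := by
            ext ω
            simp only [Set.mem_ofPred_eq, Set.mem_empty_iff_false, iff_false]
            rintro rfl
            exact hA (hcard ω)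
          simp [this]
    _ = _ := ENNReal.tsum_mul_left

lemma one_add_mul_rpow_le_exp {α c : ℝ} (hα0 : 0 < α) (hα1 : α ≤ 1) (hc : 0 ≤ c) (n : ℕ) :
    1 + c * (n + 1 : ℝ) ^ (α - 1) ≤
      Real.exp (c / α * ((n + 1 : ℝ) ^ α - (n : ℝ) ^ α)) := by
  have hn : (0 : ℝ) < n + 1 := by positivity
  have hb := rpow_one_add_le_one_add_mul_self (s := -(1 / (n + 1 : ℝ))) (p := α)
    (by rw [neg_le_neg_iff, div_le_one hn]; linarith [n.cast_nonneg (α := ℝ)]) hα0.le hα1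
  have e : 1 + -(1 / (n + 1 : ℝ)) = n / (n + 1) := by field_simp; ring
  rw [e, Real.div_rpow n.cast_nonneg hn.le, div_le_iff₀ (by positivity)] at hb
  have h1 : α * (n + 1 : ℝ) ^ (α - 1) ≤ (n + 1 : ℝ) ^ α - (n : ℝ) ^ α := by
    rw [Real.rpow_sub hn, Real.rpow_one]
    have : α * ((n + 1 : ℝ) ^ α / (n + 1)) = (n + 1 : ℝ) ^ α - (1 + α * -(1 / (n + 1 : ℝ))) * (n + 1 : ℝ) ^ α := by
      ring
    linarith
  calc 1 + c * (n + 1 : ℝ) ^ (α - 1) = c / α * (α * (n + 1 : ℝ) ^ (α - 1)) + 1 := by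
        field_simp
        ring
    _ ≤ c / α * ((n + 1 : ℝ) ^ α - (n : ℝ) ^ α) + 1 := by gcongr
    _ ≤ _ := Real.add_one_le_exp _

lemma summable_exp_neg_rpow {d : ℕ} (hd : d ≠ 0) :
    Summable fun n : ℕ => Real.exp (-(n : ℝ) ^ (2 / d : ℝ)) := by
  have hd0 : (0 : ℝ) < d := by positivity
  rw [← summable_nat_add_iff 1]
  refine Summable.of_nonneg_of_le (fun n => (Real.exp_pos _).le) (fun n => ?_)
    (((summable_nat_add_iff 1).2 (Real.summable_one_div_nat_pow.2 one_lt_two)).mul_left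
      (d.factorial : ℝ))
  have hn0 : (0 : ℝ) < (n + 1 : ℕ) := by positivity
  have h := Real.pow_div_factorial_le_exp (((n + 1 : ℕ) : ℝ) ^ (2 / d : ℝ)) (by positivity) d
  rw [← Real.rpow_natCast, ← Real.rpow_mul hn0.le, div_mul_cancel₀ _ hd0.ne', Real.rpow_ofNat] at h
  rw [Real.exp_neg, mul_one_div]
  exact (inv_anti₀ (by positivity) h).trans_eq (inv_div _ _)

/-- **External DLA on ℤ^d, d ≥ 3, growth of arms (Kesten).**  There is a constant
`C(d) < ∞` such that almost surely `limsup_{n→∞} n^{-2/d} r(E_n) ≤ C(d)`. -/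
theorem external_dla_arm_growth_Zd
    {d : ℕ} (hd : 3 ≤ d)
    {Ω : Type*} [MeasurableSpace Ω] (P : Measure Ω) [IsProbabilityMeasure P]
    (E : ℕ → Ω → Finset (Fin d → ℤ)) (Y : ℕ → Ω → (Fin d → ℤ))
    -- `μh A` is the harmonic measure from infinity of a finite set `A ⊆ ℤ^d`: the limit
    -- as `|x| → ∞` of the hitting distribution of SRW conditioned to hit `A`
    -- (the SRW is transient for `d ≥ 3`)
    (μh : Finset (Fin d → ℤ) → (Fin d → ℤ) → ℝ)
    (hμ : ∀ A : Finset (Fin d → ℤ), A.Nonempty → ∀ y ∈ A,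
      Tendsto (fun x => hitMeas latNbrs (↑A) x y / ∑ z ∈ A, hitMeas latNbrs (↑A) x z)
        cofinite (𝓝 (μh A y)))
    -- dynamics of the external DLA Markov chain, started from the origin
    (h0 : ∀ ω, E 0 ω = {0})
    (hstep : ∀ n ω, E (n+1) ω = insert (Y (n+1) ω) (E n ω))
    (hbd : ∀ n ω, Y (n+1) ω ∈ bdryF latNbrs (E n ω))
    -- the new vertex is chosen according to the harmonic measure from infinity of `∂E_n`
    (hlaw : ∀ (n : ℕ) (A : Finset (Fin d → ℤ)), ∀ y ∈ bdryF latNbrs A,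
      P {ω | E n ω = A ∧ Y (n+1) ω = y}
        = ENNReal.ofReal (μh (bdryF latNbrs A) y) * P {ω | E n ω = A}) :
    ∃ C : ℝ, ∀ᵐ ω ∂P,
      Filter.limsup
          (fun n : ℕ => (((n : ℝ) ^ (-(2:ℝ)/(d : ℝ)) * radE (E n ω) : ℝ) : EReal)) atTop
        ≤ (C : EReal) := by
    classical
  have hd0 : (0 : ℝ) < d := by positivity
  have hd3 : (3 : ℝ) ≤ d := by exact_mod_cast hd
  have : NeZero d := ⟨by omega⟩
  have : NeBot (cofinite : Filter (Fin d → ℤ)) := cofinite_neBot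
  set α : ℝ := 2 / d with hα
  have hα0 : 0 < α := by positivity
  have hα1 : α ≤ 1 := by rw [hα, div_le_one hd0]; linarith
  obtain ⟨C, hC0, hC⟩ := exists_harmonic_le hd
  set c : ℝ := C * (2 * d * Real.exp 1) with hc
  have hc0 : 0 < c := by positivity
  have hμ0 : ∀ A : Finset (Fin d → ℤ), ∀ y ∈ A, 0 ≤ μh A y := fun A y hy =>
    ge_of_tendsto' (hμ A ⟨y, hy⟩ y hy) fun x =>
      div_nonneg (hitMeas_nonneg _ _ _) (Finset.sum_nonneg fun z _ => hitMeas_nonneg _ _ _)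
  have hμ1 : ∀ A : Finset (Fin d → ℤ), ∑ y ∈ A, ENNReal.ofReal (μh A y) ≤ 1 := by
    intro A
    rw [← ENNReal.ofReal_sum_of_nonneg (hμ0 A), ENNReal.ofReal_le_one]
    refine le_of_tendsto' (tendsto_finsetSum A fun y hy => hμ A ⟨y, hy⟩ y hy) fun x => ?_
    rw [← Finset.sum_div]
    exact div_self_le_one _
  have hμC : ∀ A : Finset (Fin d → ℤ), A.Nonempty → ∀ y ∈ bdryF latNbrs A,
      μh (bdryF latNbrs A) y ≤ C * (A.card : ℝ) ^ (α - 1) := fun A hA y hy =>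
    hC A hA y _ (hμ _ ⟨y, hy⟩ y hy)
  have hcard : ∀ n ω, (E n ω).card = n + 1 := by
    intro n ω
    induction n with
    | zero => simp [h0]
    | succ n ih =>
      rw [hstep, Finset.card_insert_of_notMem (Finset.mem_sdiff.1 (hbd n ω)).2, ih]
  have hgrow : ∀ n, ∑' A, P {ω | E n ω = A} * ∑ x ∈ A, expWeight x ≤
      ENNReal.ofReal (Real.exp (c / α * (n : ℝ) ^ α)) := by
    intro n
    induction n with
    | zero =>
      rw [tsum_eq_single {0}]
      · simp [h0, expWeight, Real.zero_rpow hα0.ne']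
      · intro A hA
        simp [h0, hA.symm]
    | succ n ih =>
      refine (tsum_growth_step_le P (E n) (E (n + 1)) (Y (n + 1)) (bdryF latNbrs)
        (fun A y => ENNReal.ofReal (μh (bdryF latNbrs A) y)) expWeight
        (ENNReal.ofReal (c * (n + 1 : ℝ) ^ (α - 1))) (n + 1) (hcard n) (hstep n) (hbd n)
        (fun A y hy => (Finset.mem_sdiff.1 hy).2) (hlaw n) (fun A => hμ1 _) ?_).trans ?_
      · intro A hA
        have hAne : A.Nonempty := Finset.card_pos.1 (by omega)
        calc ∑ y ∈ bdryF latNbrs A, ENNReal.ofReal (μh (bdryF latNbrs A) y) * expWeight y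
            ≤ ∑ y ∈ bdryF latNbrs A, ENNReal.ofReal (C * (n + 1 : ℝ) ^ (α - 1)) * expWeight y := by
              gcongr with y hy
              have := hμC A hAne y hy
              rw [hA] at this
              exact_mod_cast this
          _ ≤ ENNReal.ofReal (C * (n + 1 : ℝ) ^ (α - 1)) *
              (ENNReal.ofReal (2 * d * Real.exp 1) * ∑ x ∈ A, expWeight x) := by
              rw [← Finset.mul_sum]
              gcongr
              exact sum_bdryF_expWeight_le A
          _ = _ := by
              rw [← mul_assoc, ← ENNReal.ofReal_mul (by positivity)]
              congr 2
              rw [hc]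
              ring
      · calc _ ≤ (1 + ENNReal.ofReal (c * (n + 1 : ℝ) ^ (α - 1))) *
              ENNReal.ofReal (Real.exp (c / α * (n : ℝ) ^ α)) := by gcongr
          _ = ENNReal.ofReal ((1 + c * (n + 1 : ℝ) ^ (α - 1)) *
              Real.exp (c / α * (n : ℝ) ^ α)) := by
              rw [ENNReal.ofReal_mul (p := 1 + c * (n + 1 : ℝ) ^ (α - 1)) (by positivity),
                ENNReal.ofReal_add zero_le_one (by positivity),
                ENNReal.ofReal_one]
          _ ≤ _ := by
              refine ENNReal.ofReal_le_ofReal ?_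
              calc _ ≤ Real.exp (c / α * ((n + 1 : ℝ) ^ α - (n : ℝ) ^ α)) *
                    Real.exp (c / α * (n : ℝ) ^ α) := by
                    gcongr
                    exact one_add_mul_rpow_le_exp hα0 hα1 hc0.le n
                _ = _ := by
                    rw [← Real.exp_add]
                    push_cast
                    ring_nf
  set K : ℝ := c / α + 1 with hK
  have hK0 : 0 < K := by positivity
  have htail : ∀ n : ℕ, P {ω | K * (n : ℝ) ^ α < radE (E n ω)} ≤
      ENNReal.ofReal (Real.exp (-(n : ℝ) ^ α)) := by
    intro n
    set R : ℝ := K * (n : ℝ) ^ α with hR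
    have hexp0 : ENNReal.ofReal (Real.exp R) ≠ 0 := by simp [Real.exp_pos]
    have hmarkov : P {ω | R < radE (E n ω)} * ENNReal.ofReal (Real.exp R) ≤
        ∑' A, P {ω | E n ω = A} * ∑ x ∈ A, expWeight x := by
      calc P {ω | R < radE (E n ω)} * ENNReal.ofReal (Real.exp R)
          ≤ (∑' A, P {ω | E n ω = A ∧ R < radE A}) * ENNReal.ofReal (Real.exp R) := by
            gcongr
            refine (measure_mono fun ω hω => ?_).trans (measure_iUnion_le _)
            exact Set.mem_iUnion.2 ⟨E n ω, rfl, hω⟩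
        _ = ∑' A, P {ω | E n ω = A ∧ R < radE A} * ENNReal.ofReal (Real.exp R) :=
            ENNReal.tsum_mul_right.symm
        _ ≤ _ := by
            refine ENNReal.tsum_le_tsum fun A => ?_
            by_cases hA : R < radE A
            · obtain ⟨x, hx, hxR⟩ := exists_lt_eunorm_of_lt_radE (by positivity) hA
              simp only [hA, and_true]
              gcongr
              exact (ofReal_exp_le_expWeight hxR.le).trans
                (Finset.single_le_sum (fun _ _ => zero_le) hx)
            · simp [hA]
    have h1 := hmarkov.trans (hgrow n)
    rw [← ENNReal.le_div_iff_mul_le (Or.inl hexp0) (Or.inl ENNReal.ofReal_ne_top),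
      ← ENNReal.ofReal_div_of_pos (Real.exp_pos _), ← Real.exp_sub] at h1
    convert h1 using 4
    rw [hR, hK]
    ring
  have hsum : ∑' n : ℕ, P {ω | K * (n : ℝ) ^ α < radE (E n ω)} ≠ ⊤ := by
    refine ne_top_of_le_ne_top ?_ (ENNReal.tsum_le_tsum htail)
    exact (summable_exp_neg_rpow (by omega)).tsum_ofReal_ne_top
  refine ⟨K, ?_⟩
  filter_upwards [ae_eventually_notMem hsum] with ω hω
  refine limsup_le_of_le (by isBoundedDefault) ?_
  filter_upwards [hω, eventually_gt_atTop 0] with n hn hn0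
  have hn0' : (0 : ℝ) < n := by exact_mod_cast hn0
  have hrad : radE (E n ω) ≤ K * (n : ℝ) ^ α := not_lt.1 hn
  refine EReal.coe_le_coe_iff.2 ?_
  calc (n : ℝ) ^ (-(2 : ℝ) / d) * radE (E n ω) ≤ (n : ℝ) ^ (-(2 : ℝ) / d) * (K * (n : ℝ) ^ α) := by
        gcongr
    _ = K := by
        rw [mul_left_comm, ← Real.rpow_add hn0', hα, ← add_div]
        simp
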